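/- Let r be a power of p and m = (m_j)_{j≥0} an integer sequence with m_0 = 1 and m_j ≥ 2 for all j ≥ 1. Let a = (a_j)_{j≥0} and a' = (a'_j)_{j≥0} be two distinct sequences with values in {0,1}, each taking the value 1 infinitely often, and let j_0 be the least index with a_{j_0} ≠ a'_{j_0}. Then |ξ_a(r,m) − ξ_{a'}(r,m)| = q^{-r_{j_0}}; in particular ξ_a(r,m) ≠ ξ_{a'}(r,m). -/

import Mathlib

open Polynomial Filter Set
open scoped Classical

noncomputable section

namespace OotoT

variable (Fq : Type) [Field Fq]

/-- We model the field `F_q((T⁻¹))` of Laurent series in `T⁻¹` as `LaurentSeries Fq`,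
whose canonical variable `u` plays the role of `T⁻¹`.  Thus `T` itself is `u⁻¹`. -/
def Tel : LaurentSeries Fq := (HahnSeries.single (1 : ℤ) (1 : Fq))⁻¹

/-- The canonical ring embedding `F_q[T] → F_q((T⁻¹))`, sending `T ↦ u⁻¹`. -/
def ringHomT : Polynomial Fq →+* LaurentSeries Fq :=
  Polynomial.eval₂RingHom (HahnSeries.C : Fq →+* LaurentSeries Fq) (Tel Fq)

/-- The absolute value on `F_q((T⁻¹))`: `|0| = 0` and `|ξ| = q^{-N}` where
`ξ = Σ_{n ≥ N} a_n T^{-n}` with `a_N ≠ 0`; in our model `N` is the order of `ξ`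
as a Hahn series in `u = T⁻¹`. -/
def absL (q : ℕ) (ξ : LaurentSeries Fq) : ℝ :=
  if ξ = 0 then 0 else (q : ℝ) ^ (-ξ.order)

/-- Evaluation of a polynomial `P(X) ∈ (F_q[T])[X]` at `ξ ∈ F_q((T⁻¹))`. -/
def evalP (ξ : LaurentSeries Fq) (P : Polynomial (Polynomial Fq)) : LaurentSeries Fq :=
  Polynomial.eval₂ (ringHomT Fq) ξ P

/-- The height of `P(X) ∈ (F_q[T])[X]`: the maximum of the absolute values of its
coefficients.  A nonzero `c ∈ F_q[T]` has `|c| = q^{deg c}`, so for `P ≠ 0` the height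
is `q` raised to the maximal degree of a (nonzero) coefficient of `P`. -/
def heightP (q : ℕ) (P : Polynomial (Polynomial Fq)) : ℝ :=
  if P = 0 then 0 else (q : ℝ) ^ (P.support.sup fun i => (P.coeff i).natDegree)

/-- `w_n(ξ)`: the supremum (in the extended reals) of the real numbers `w` such that
`0 < |P(ξ)| ≤ H(P)^{-w}` for infinitely many `P(X) ∈ (F_q[T])[X]` of degree at most `n`. -/
def wn (q : ℕ) (n : ℕ) (ξ : LaurentSeries Fq) : EReal :=
  sSup ((fun w : ℝ => (w : EReal)) ''
    {w : ℝ | {P : Polynomial (Polynomial Fq) | P.natDegree ≤ n ∧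
      0 < absL Fq q (evalP Fq ξ P) ∧
      absL Fq q (evalP Fq ξ P) ≤ heightP Fq q P ^ (-w)}.Infinite})

/-- `w(ξ) = limsup_{n→∞} w_n(ξ)/n`. -/
def wB (q : ℕ) (ξ : LaurentSeries Fq) : EReal :=
  Filter.limsup (fun n : ℕ => wn Fq q n ξ / (n : EReal)) Filter.atTop

/-- `ξ` is an `A`-number if `w(ξ) = 0`. -/
def IsANumber (q : ℕ) (ξ : LaurentSeries Fq) : Prop := wB Fq q ξ = 0

/-- `ξ` is an `S`-number if `0 < w(ξ) < +∞`. -/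
def IsSNumber (q : ℕ) (ξ : LaurentSeries Fq) : Prop := 0 < wB Fq q ξ ∧ wB Fq q ξ < ⊤

/-- `ξ` is a `T`-number if `w(ξ) = +∞` and `w_n(ξ) < +∞` for all `n ≥ 1`. -/
def IsTNumber (q : ℕ) (ξ : LaurentSeries Fq) : Prop :=
  wB Fq q ξ = ⊤ ∧ ∀ n : ℕ, 1 ≤ n → wn Fq q n ξ < ⊤

/-- `ξ` is a `U`-number if `w(ξ) = +∞` and `w_n(ξ) = +∞` for some `n ≥ 1`. -/
def IsUNumber (q : ℕ) (ξ : LaurentSeries Fq) : Prop :=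
  wB Fq q ξ = ⊤ ∧ ∃ n : ℕ, 1 ≤ n ∧ wn Fq q n ξ = ⊤

/-- The type `t(ξ) = limsup_{n→∞} (log w_n(ξ))/(log n)` of a `T`-number (as an
extended real; for a `T`-number each `w_n(ξ)` is a finite real, recovered by `toReal`). -/
def typeT (q : ℕ) (ξ : LaurentSeries Fq) : EReal :=
  Filter.limsup
    (fun n : ℕ => ((Real.log (wn Fq q n ξ).toReal / Real.log n : ℝ) : EReal)) Filter.atTop

/-! ### The algebraic closure side -/

/-- The algebraic closure of `F_q((T⁻¹))`. -/
abbrev AC := AlgebraicClosure (LaurentSeries Fq)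

/-- The canonical embedding of `F_q((T⁻¹))` into its algebraic closure. -/
def iota : LaurentSeries Fq →+* AC Fq := algebraMap _ _

/-- The embedding `F_q[T] → AC`. -/
def ringHomTC : Polynomial Fq →+* AC Fq := (iota Fq).comp (ringHomT Fq)

/-- Evaluation of `P(X) ∈ (F_q[T])[X]` at an element of the algebraic closure. -/
def evalPC (α : AC Fq) (P : Polynomial (Polynomial Fq)) : AC Fq :=
  Polynomial.eval₂ (ringHomTC Fq) α P

/-- `P ∈ (F_q[T])[X]` is *the* minimal polynomial of `α`: it is non-constant, irreducible,
primitive, its leading coefficient is monic (in `T`), and `P(α) = 0`.  For `α` algebraic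
over `F_q(T)` such a polynomial exists and is unique. -/
def IsMinPolyOf (α : AC Fq) (P : Polynomial (Polynomial Fq)) : Prop :=
  0 < P.natDegree ∧ Irreducible P ∧ P.IsPrimitive ∧ P.leadingCoeff.Monic ∧ evalPC Fq α P = 0

/-- `α` is algebraic over `F_q(T)`. -/
def IsAlgT (α : AC Fq) : Prop := ∃ P, IsMinPolyOf Fq α P

/-- The degree of an algebraic `α`: the degree of its minimal polynomial. -/
def degT (α : AC Fq) : ℕ := if h : IsAlgT Fq α then h.choose.natDegree else 0

/-- The height of an algebraic `α`: the height of its minimal polynomial. -/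
def heightT (q : ℕ) (α : AC Fq) : ℝ := if h : IsAlgT Fq α then heightP Fq q h.choose else 0

/-- The unique extension of the absolute value to the algebraic closure of `F_q((T⁻¹))`,
given by the standard formula `|x| = |N_{K(x)/K}(x)|^{1/[K(x):K]}`, i.e.
`|x| = |c₀|^{1/d}` where `c₀` is the constant coefficient and `d` the degree of the
minimal polynomial of `x` over `K = F_q((T⁻¹))`. -/
def absC (q : ℕ) (x : AC Fq) : ℝ :=
  absL Fq q ((minpoly (LaurentSeries Fq) x).coeff 0) ^
    (((minpoly (LaurentSeries Fq) x).natDegree : ℝ)⁻¹)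

/-- `w_n^*(ξ)`: the supremum (in the extended reals) of the real numbers `w` such that
`0 < |ξ - α| ≤ H(α)^{-w-1}` for infinitely many `α` algebraic over `F_q(T)` of degree
at most `n`. -/
def wnStar (q : ℕ) (n : ℕ) (ξ : LaurentSeries Fq) : EReal :=
  sSup ((fun w : ℝ => (w : EReal)) ''
    {w : ℝ | {α : AC Fq | IsAlgT Fq α ∧ degT Fq α ≤ n ∧
      0 < absC Fq q (iota Fq ξ - α) ∧
      absC Fq q (iota Fq ξ - α) ≤ heightT Fq q α ^ (-w - 1)}.Infinite})

/-- `w^*(ξ) = limsup_{n→∞} w_n^*(ξ)/n`. -/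
def wBStar (q : ℕ) (ξ : LaurentSeries Fq) : EReal :=
  Filter.limsup (fun n : ℕ => wnStar Fq q n ξ / (n : EReal)) Filter.atTop

/-- `ξ` is an `A*`-number if `w^*(ξ) = 0`. -/
def IsAStarNumber (q : ℕ) (ξ : LaurentSeries Fq) : Prop := wBStar Fq q ξ = 0

/-- `ξ` is a `T*`-number if `w^*(ξ) = +∞` and `w_n^*(ξ) < +∞` for all `n ≥ 1`. -/
def IsTStarNumber (q : ℕ) (ξ : LaurentSeries Fq) : Prop :=
  wBStar Fq q ξ = ⊤ ∧ ∀ n : ℕ, 1 ≤ n → wnStar Fq q n ξ < ⊤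

/-- The `*`-type `t^*(ξ) = limsup_{n→∞} (log w_n^*(ξ))/(log n)` of a `T*`-number. -/
def typeTStar (q : ℕ) (ξ : LaurentSeries Fq) : EReal :=
  Filter.limsup
    (fun n : ℕ => ((Real.log (wnStar Fq q n ξ).toReal / Real.log n : ℝ) : EReal)) Filter.atTop

/-! ### The Laurent series `ξ(r, m)` -/

/-- `r_j = r^{m_0 m_1 ⋯ m_j}`. -/
def rr (r : ℕ) (m : ℕ → ℕ) (j : ℕ) : ℕ := r ^ (∏ i ∈ Finset.range (j + 1), m i)

/-- `α_j(r, m) = Σ_{n=1}^∞ T^{-r_j^n}`, i.e. the power series in `u = T⁻¹` whose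
`k`-th coefficient is `1` exactly when `k = r_j^n` for some `n ≥ 1`. -/
def alphaJ (r : ℕ) (m : ℕ → ℕ) (j : ℕ) : LaurentSeries Fq :=
  HahnSeries.ofPowerSeries ℤ Fq (PowerSeries.mk fun k =>
    if ∃ n : ℕ, 1 ≤ n ∧ k = rr r m j ^ n then 1 else 0)

/-- `ξ_a(r, m) = Σ_{j=0}^∞ a_j α_j(r, m)`, described coefficientwise: the coefficient of
`T^{-k}` is the (finite) sum over `j` of `a_j` times the coefficient of `T^{-k}` in
`α_j(r, m)`. -/
def xiA (r : ℕ) (m : ℕ → ℕ) (a : ℕ → ℕ) : LaurentSeries Fq :=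
  HahnSeries.ofPowerSeries ℤ Fq (PowerSeries.mk fun k =>
    ∑ᶠ j : ℕ, (a j : Fq) * (if ∃ n : ℕ, 1 ≤ n ∧ k = rr r m j ^ n then 1 else 0))

/-- `ξ(r, m) = Σ_{j=0}^∞ α_j(r, m)`. -/
def xi (r : ℕ) (m : ℕ → ℕ) : LaurentSeries Fq := xiA Fq r m fun _ => 1

/-! ### Algebraicity and algebraic dependence over `F_q(T)` for Laurent series -/

/-- `ξ ∈ F_q((T⁻¹))` is algebraic over `F_q(T)`. -/
def IsAlgLS (ξ : LaurentSeries Fq) : Prop :=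
  ∃ P : Polynomial (Polynomial Fq), P ≠ 0 ∧ evalP Fq ξ P = 0

/-- Evaluation of a two-variable polynomial `F(X, Y) ∈ (F_q[T])[X, Y]` (coded as an
iterated polynomial ring, `T` innermost, then `X`, then `Y`) at `(ξ, η)`. -/
def evalXY (ξ η : LaurentSeries Fq) (F : Polynomial (Polynomial (Polynomial Fq))) :
    LaurentSeries Fq :=
  Polynomial.eval₂ (Polynomial.eval₂RingHom (ringHomT Fq) ξ) η F

/-- `ξ` and `η` are algebraically dependent over `F_q(T)`. -/
def AlgDep (ξ η : LaurentSeries Fq) : Prop :=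
  ∃ F : Polynomial (Polynomial (Polynomial Fq)), F ≠ 0 ∧ evalXY Fq ξ η F = 0

/-- `deg_X` of `F(X, Y) ∈ (F_q[T])[X, Y]` in our encoding. -/
def degX (F : Polynomial (Polynomial (Polynomial Fq))) : ℕ :=
  F.support.sup fun i => (F.coeff i).natDegree

/-- `F(X, Y) ∈ (F_q[T])[X, Y]` is primitive (in `X` and `Y`): no non-unit of `F_q[T]`
divides all of its coefficients. -/
def IsPrimitiveXY (F : Polynomial (Polynomial (Polynomial Fq))) : Prop :=
  ∀ c : Polynomial Fq, (∀ i j : ℕ, c ∣ ((F.coeff i).coeff j)) → IsUnit c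

end OotoT

open OotoT

namespace OotoT

/-- The sequence `r_j` is strictly increasing. -/
theorem rr_strictMono {r : ℕ} (hr : 1 < r) {m : ℕ → ℕ} (hm0 : 0 < m 0)
    (hm : ∀ j : ℕ, 1 ≤ j → 2 ≤ m j) : StrictMono (rr r m) := by
  refine strictMono_nat_of_lt_succ fun j => Nat.pow_lt_pow_right hr ?_
  have hpos : 0 < ∏ i ∈ Finset.range (j + 1), m i := by
    refine Finset.prod_pos fun i _ => ?_
    rcases Nat.eq_zero_or_pos i with rfl | hi
    · exact hm0
    · exact lt_of_lt_of_le two_pos (hm i hi)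
  rw [Finset.prod_range_succ _ (j + 1)]
  exact lt_mul_of_one_lt_right hpos (hm (j + 1) (Nat.le_add_left 1 j))

/-- Only the indices `j ≤ j₀` contribute to the coefficient of `T^{-k}` in `ξ_a(r, m)`
when `k ≤ r_{j₀}`. -/
theorem finsum_coeff_eq_sum_range {R : Type*} [Semiring R] {r : ℕ} {m : ℕ → ℕ}
    (hmono : StrictMono (rr r m)) (a : ℕ → ℕ) {j₀ k : ℕ} (hk : k ≤ rr r m j₀) :
    ∑ᶠ j : ℕ, (a j : R) * (if ∃ n : ℕ, 1 ≤ n ∧ k = rr r m j ^ n then 1 else 0) =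
      ∑ j ∈ Finset.range (j₀ + 1),
        (a j : R) * (if ∃ n : ℕ, 1 ≤ n ∧ k = rr r m j ^ n then 1 else 0) := by
  refine finsum_eq_sum_of_support_subset _ fun j hj => ?_
  simp only [Function.mem_support, ne_eq, mul_ite, mul_one, mul_zero, ite_eq_right_iff,
    Classical.not_imp] at hj
  obtain ⟨⟨n, hn, rfl⟩, -⟩ := hj
  have hle : rr r m j ≤ rr r m j₀ :=
    (Nat.le_self_pow (Nat.one_le_iff_ne_zero.mp hn) _).trans hk
  simpa [Nat.lt_succ_iff] using hmono.le_iff_le.mp hle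

/-- The order of a power series seen as a Laurent series is determined by its first
nonzero coefficient. -/
theorem order_ofPowerSeries_eq {R : Type*} [Semiring R] {f : PowerSeries R} {N : ℕ}
    (hN : PowerSeries.coeff N f ≠ 0) (hlt : ∀ k < N, PowerSeries.coeff k f = 0) :
    (HahnSeries.ofPowerSeries ℤ R f).order = N := by
  have hcoeff : (HahnSeries.ofPowerSeries ℤ R f).coeff (N : ℤ) ≠ 0 := by
    rwa [HahnSeries.ofPowerSeries_apply_coeff]
  have hne : HahnSeries.ofPowerSeries ℤ R f ≠ 0 := fun h0 => hcoeff (by simp [h0])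
  refine le_antisymm (HahnSeries.order_le_of_coeff_ne_zero hcoeff)
    ((HahnSeries.le_order_iff_forall hne).mpr fun i hi => ?_)
  rw [PowerSeries.coeff_coe]
  split_ifs with hneg
  · rfl
  · exact hlt _ (by omega)

end OotoT

/-- For two distinct `{0,1}`-valued sequences `a`, `a'`, each taking the
value `1` infinitely often, with least disagreement index `j₀`:
`|ξ_a(r,m) − ξ_{a'}(r,m)| = q^{-r_{j₀}}`; in particular `ξ_a(r,m) ≠ ξ_{a'}(r,m)`. -/
theorem xiA_dist (p : ℕ) (hp : p.Prime) (q : ℕ) (hq : ∃ e : ℕ, 0 < e ∧ q = p ^ e)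
    (Fq : Type) [Field Fq] [Fintype Fq] [CharP Fq p] (hcard : Fintype.card Fq = q)
    (r : ℕ) (hr : ∃ e : ℕ, 0 < e ∧ r = p ^ e)
    (m : ℕ → ℕ) (hm0 : m 0 = 1) (hm : ∀ j : ℕ, 1 ≤ j → 2 ≤ m j)
    (a a' : ℕ → ℕ) (ha : ∀ j, a j ≤ 1) (ha' : ∀ j, a' j ≤ 1)
    (hainf : ∃ᶠ j in Filter.atTop, a j = 1) (ha'inf : ∃ᶠ j in Filter.atTop, a' j = 1)
    (hne : a ≠ a') (j₀ : ℕ) (hj₀ : a j₀ ≠ a' j₀) (hj₀min : ∀ i : ℕ, i < j₀ → a i = a' i) :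
    absL Fq q (xiA Fq r m a - xiA Fq r m a') = (q : ℝ) ^ (-(rr r m j₀ : ℤ)) ∧
      xiA Fq r m a ≠ xiA Fq r m a' := by
  obtain ⟨e, he, rfl⟩ := hr
  have hmono : StrictMono (rr (p ^ e) m) :=
    rr_strictMono (Nat.one_lt_pow he.ne' hp.one_lt) (by omega) hm
  have hdiff : (a j₀ : Fq) - a' j₀ ≠ 0 := by
    have h := ha j₀
    have h' := ha' j₀
    rw [sub_ne_zero]
    interval_cases a j₀ <;> interval_cases a' j₀ <;> simp_all
  let c : (ℕ → ℕ) → PowerSeries Fq := fun b => PowerSeries.mk fun k =>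
    ∑ᶠ j : ℕ, (b j : Fq) * (if ∃ n : ℕ, 1 ≤ n ∧ k = rr (p ^ e) m j ^ n then 1 else 0)
  have hcoeff : ∀ k ≤ rr (p ^ e) m j₀, PowerSeries.coeff k (c a - c a') =
      ((a j₀ : Fq) - a' j₀) *
        (if ∃ n : ℕ, 1 ≤ n ∧ k = rr (p ^ e) m j₀ ^ n then 1 else 0) := by
    intro k hk
    simp only [c, map_sub, PowerSeries.coeff_mk, finsum_coeff_eq_sum_range hmono _ hk]
    rw [← Finset.sum_sub_distrib, Finset.sum_range_succ, Finset.sum_eq_zero, zero_add, sub_mul]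
    intro j hj
    rw [hj₀min j (Finset.mem_range.mp hj), sub_self]
  have htop : PowerSeries.coeff (rr (p ^ e) m j₀) (c a - c a') ≠ 0 := by
    rw [hcoeff _ le_rfl, if_pos ⟨1, le_rfl, (pow_one _).symm⟩, mul_one]
    exact hdiff
  have hlow : ∀ k < rr (p ^ e) m j₀, PowerSeries.coeff k (c a - c a') = 0 := by
    intro k hk
    rw [hcoeff k hk.le, if_neg, mul_zero]
    rintro ⟨n, hn, rfl⟩
    exact hk.not_ge (Nat.le_self_pow (Nat.one_le_iff_ne_zero.mp hn) _)
  have hsub : xiA Fq (p ^ e) m a - xiA Fq (p ^ e) m a' =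
      HahnSeries.ofPowerSeries ℤ Fq (c a - c a') := (map_sub _ _ _).symm
  have hne0 : xiA Fq (p ^ e) m a - xiA Fq (p ^ e) m a' ≠ 0 := by
    rw [hsub]
    intro h
    exact htop (by rw [← HahnSeries.ofPowerSeries_apply_coeff (Γ := ℤ), h]; simp)
  refine ⟨?_, sub_ne_zero.mp hne0⟩
  rw [absL, if_neg hne0, hsub, order_ofPowerSeries_eq htop hlow]
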